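/- Let P = (p₁, p₂, …) be a sequence of nonzero integers and let c, d be nonzero coprime integers such that d has a prime factor p which divides p_i for only finitely many i. Then there is no continuous function h : C_P → Σ_P (C_P carrying the subspace topology from Σ_P) such that h(π_P(s)) = π_P((c/d)·s) for all s ∈ ℝ. -/

import Mathlib

noncomputable section

/-- The `1`-solenoid determined by a sequence `P` of integers: the inverse limit of
circles `ℝ/ℤ` where the `j`-th bonding map is multiplication by `P j`, realized as a
closed subgroup of the countable product of circles. -/
def Sol1 (P : ℕ → ℤ) : AddSubgroup (ℕ → AddCircle (1 : ℝ)) where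
  carrier := {x | ∀ j, P j • x (j + 1) = x j}
  zero_mem' := by
    intro j
    simp
  add_mem' := by
    intro a b ha hb j
    simp only [Pi.add_apply, smul_add, ha j, hb j]
  neg_mem' := by
    intro a ha j
    simp only [Pi.neg_apply, smul_neg, ha j]

/-- The sequence `t, t/p₁, t/(p₁p₂), …` of real numbers. -/
def sol1PiVec (P : ℕ → ℤ) (t : ℝ) : ℕ → ℝ
  | 0 => t
  | j + 1 => sol1PiVec P t j / (P j : ℝ)

/-- The canonical homomorphism `π_P : ℝ → Σ_P`,
`π_P t = (t, t/p₁, t/(p₁p₂), …) (mod 1)`. -/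
def sol1Pi (P : ℕ → ℤ) (hP : ∀ j, P j ≠ 0) (t : ℝ) : Sol1 P :=
  ⟨fun j => (sol1PiVec P t j : AddCircle (1 : ℝ)), by
    intro j
    have h2 : (P j : ℝ) ≠ 0 := by exact_mod_cast hP j
    show P j • ((sol1PiVec P t j / (P j : ℝ) : ℝ) : AddCircle (1 : ℝ))
        = ((sol1PiVec P t j : ℝ) : AddCircle (1 : ℝ))
    calc P j • ((sol1PiVec P t j / (P j : ℝ) : ℝ) : AddCircle (1 : ℝ))
        = ((P j • (sol1PiVec P t j / (P j : ℝ)) : ℝ) : AddCircle (1 : ℝ)) := by norm_cast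
      _ = ((sol1PiVec P t j : ℝ) : AddCircle (1 : ℝ)) := by
          rw [zsmul_eq_mul, mul_div_cancel₀ _ h2]⟩

theorem sol1PiVec_eq_div_prod (P : ℕ → ℤ) (t : ℝ) (j : ℕ) :
    sol1PiVec P t j = t / ((∏ i ∈ Finset.range j, P i : ℤ) : ℝ) := by
  induction j with
  | zero => simp [sol1PiVec]
  | succ j ih =>
    rw [sol1PiVec, ih, Finset.prod_range_succ, Int.cast_mul, div_div]

theorem sol1Pi_apply (P : ℕ → ℤ) (hP : ∀ j, P j ≠ 0) (t : ℝ) (j : ℕ) :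
    (sol1Pi P hP t : ℕ → AddCircle (1 : ℝ)) j =
      ((t / ((∏ i ∈ Finset.range j, P i : ℤ) : ℝ) : ℝ) : AddCircle (1 : ℝ)) := by
  rw [← sol1PiVec_eq_div_prod]
  rfl

theorem continuous_sol1Pi (P : ℕ → ℤ) (hP : ∀ j, P j ≠ 0) : Continuous (sol1Pi P hP) := by
  refine Continuous.subtype_mk (continuous_pi fun j => ?_) _
  simp only [sol1PiVec_eq_div_prod]
  exact (AddCircle.continuous_mk' 1).comp (continuous_id.div_const _)

theorem sol1Pi_zero (P : ℕ → ℤ) (hP : ∀ j, P j ≠ 0) : sol1Pi P hP 0 = 0 := by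
  ext j
  rw [sol1Pi_apply]
  simp

theorem sol1Pi_mem_pathComponent_zero (P : ℕ → ℤ) (hP : ∀ j, P j ≠ 0) (t : ℝ) :
    sol1Pi P hP t ∈ pathComponent (0 : Sol1 P) := by
  rw [← sol1Pi_zero P hP]
  exact ((isPathConnected_range (continuous_sol1Pi P hP)).joinedIn _ ⟨0, rfl⟩ _ ⟨t, rfl⟩).joined

theorem coe_div_intCast_eq_zero_iff {m d : ℤ} (hd : d ≠ 0) :
    (((m : ℝ) / (d : ℝ) : ℝ) : AddCircle (1 : ℝ)) = 0 ↔ d ∣ m := by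
  have hd' : (d : ℝ) ≠ 0 := by exact_mod_cast hd
  rw [AddCircle.coe_eq_zero_iff]
  constructor
  · rintro ⟨n, hn⟩
    rw [zsmul_eq_mul, mul_one, eq_div_iff hd'] at hn
    exact ⟨n, by rw [mul_comm]; exact_mod_cast hn.symm⟩
  · rintro ⟨n, rfl⟩
    exact ⟨n, by push_cast; field_simp; simp⟩

/-- The real numbers `p₁ ⋯ pₙ` have images in the solenoid converging to the identity. -/
theorem tendsto_sol1Pi_prod (P : ℕ → ℤ) (hP : ∀ j, P j ≠ 0) :
    Filter.Tendsto (fun n => sol1Pi P hP ((∏ i ∈ Finset.range n, P i : ℤ) : ℝ))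
      Filter.atTop (nhds 0) := by
  rw [tendsto_subtype_rng, tendsto_pi_nhds]
  intro j
  refine tendsto_const_nhds.congr' ?_
  filter_upwards [Filter.eventually_ge_atTop j] with n hn
  rw [sol1Pi_apply]
  exact ((coe_div_intCast_eq_zero_iff (Finset.prod_ne_zero_iff.2 fun i _ => hP i)).2
    (Finset.prod_dvd_prod_of_subset _ _ _ (Finset.range_mono hn))).symm

/-- Fractions with a fixed denominator that are not integers stay away from `0` in `ℝ/ℤ`. -/
theorem not_tendsto_coe_div_intCast {d : ℤ} (hd : d ≠ 0) {m : ℕ → ℤ}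
    (hm : ∀ᶠ n in Filter.atTop, ¬ d ∣ m n) :
    ¬ Filter.Tendsto (fun n => (((m n : ℝ) / (d : ℝ) : ℝ) : AddCircle (1 : ℝ)))
      Filter.atTop (nhds 0) := by
  intro h
  have hd' : (d : ℝ) ≠ 0 := by exact_mod_cast hd
  have : Fact ((0 : ℝ) < 1) := ⟨one_pos⟩
  have hfin : {x : AddCircle (1 : ℝ) | d • x = 0}.Finite := by
    refine (AddCircle.finite_torsion (1 : ℝ) (Int.natAbs_pos.2 hd)).subset fun x hx => ?_
    exact natAbs_nsmul_eq_zero.2 hx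
  have hopen : ({x : AddCircle (1 : ℝ) | d • x = 0} \ {0})ᶜ ∈ nhds (0 : AddCircle (1 : ℝ)) :=
    (hfin.subset Set.sdiff_subset).isClosed.isOpen_compl.mem_nhds (by simp)
  obtain ⟨n, hn, hmn⟩ := ((h.eventually hopen).and hm).exists
  refine hn ⟨?_, fun h0 => hmn ((coe_div_intCast_eq_zero_iff hd).1 h0)⟩
  change d • (((m n : ℝ) / (d : ℝ) : ℝ) : AddCircle (1 : ℝ)) = 0
  rw [← AddCircle.coe_zsmul, zsmul_eq_mul, mul_div_cancel₀ _ hd', AddCircle.coe_eq_zero_iff]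
  exact ⟨m n, by simp⟩

/-- If `c, d` are nonzero coprime integers and `d` has a prime factor `p` dividing
only finitely many terms of `P`, then there is no continuous map `h` from the path
component `C_P` of the identity in `Σ_P` to `Σ_P` with `h (π_P s) = π_P ((c/d) s)`
for all `s ∈ ℝ`. -/
theorem sol1_bad_rational_multiplier_not_continuous (P : ℕ → ℤ)
    (hP : ∀ j, P j ≠ 0) (c d : ℤ) (hc : c ≠ 0) (hd : d ≠ 0)
    (hcd : IsCoprime c d) (p : ℕ) (hp : p.Prime) (hpd : (p : ℤ) ∣ d)
    (hfin : {i : ℕ | (p : ℤ) ∣ P i}.Finite) :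
    ¬ ∃ h : ↥(Sol1 P) → ↥(Sol1 P),
        ContinuousOn h (pathComponent (0 : ↥(Sol1 P))) ∧
        ∀ s : ℝ, h (sol1Pi P hP s) = sol1Pi P hP ((c : ℝ) / (d : ℝ) * s) := by
  rintro ⟨h, hcont, hh⟩
  have hp' : Prime (p : ℤ) := Nat.prime_iff_prime_int.1 hp
  obtain ⟨N, hN⟩ : ∃ N, ∀ i, N ≤ i → ¬ (p : ℤ) ∣ P i := by
    obtain ⟨B, hB⟩ := hfin.bddAbove
    exact ⟨B + 1, fun i hi hpi => absurd (hB hpi) (by omega)⟩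
  have hpc : ¬ (p : ℤ) ∣ c := fun hpc => hp'.not_isUnit (hcd.isUnit_of_dvd' hpc hpd)
  have h0 : h 0 = 0 := by
    have := hh 0
    rwa [mul_zero, sol1Pi_zero] at this
  have hlim : Filter.Tendsto
      (fun n => h (sol1Pi P hP ((∏ i ∈ Finset.range n, P i : ℤ) : ℝ)))
      Filter.atTop (nhds 0) := by
    have hc0 := hcont 0 (mem_pathComponent_self 0)
    rw [ContinuousWithinAt, h0] at hc0
    exact hc0.comp (tendsto_nhdsWithin_iff.2 ⟨tendsto_sol1Pi_prod P hP,
      Filter.Eventually.of_forall fun _ => sol1Pi_mem_pathComponent_zero P hP _⟩)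
  simp only [hh] at hlim
  rw [tendsto_subtype_rng, tendsto_pi_nhds] at hlim
  refine not_tendsto_coe_div_intCast hd (m := fun n => c * ∏ i ∈ Finset.Ico N n, P i)
    (Filter.Eventually.of_forall fun n hdvd => ?_) ((hlim N).congr' ?_)
  · rcases hp'.dvd_or_dvd (hpd.trans hdvd) with h1 | h1
    · exact hpc h1
    · obtain ⟨i, hi, hpi⟩ := hp'.exists_mem_finset_dvd h1
      exact hN i (Finset.mem_Ico.1 hi).1 hpi
  · filter_upwards [Filter.eventually_ge_atTop N] with n hn
    have hne : ((∏ i ∈ Finset.range N, P i : ℤ) : ℝ) ≠ 0 :=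
      Int.cast_ne_zero.2 (Finset.prod_ne_zero_iff.2 fun i _ => hP i)
    rw [sol1Pi_apply, ← Finset.prod_range_mul_prod_Ico P hn]
    congr 1
    rw [Int.cast_mul, Int.cast_mul]
    field_simp

end
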